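/- arXiv:1810.07560 — 2 statements merged into one kernel-verified Lean document; each statement's English description precedes it below -/
import Mathlib

section
/- For all positive integers n ≥ k, the rationals F_{n,k} satisfy the recurrence F_{n+1,k} = (k/(n+1))·F_{n,k-1} + (n/(n+1))·F_{n,k}. -/
/-- `F n k = ∑ 1/(i₁⋯i_k)` over ordered `k`-tuples of positive integers with sum `n`. -/
def F (n k : ℕ) : ℚ :=
  ∑ f ∈ (Finset.Nat.antidiagonalTuple k n).filter (fun f => ∀ j, f j ≠ 0),
    ∏ j, (1 : ℚ) / (f j : ℚ)

/-- The series `∑ X^i / i` (the constant term is `1 / 0 = 0`). -/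
noncomputable def logSer : PowerSeries ℚ := PowerSeries.mk fun i => (1 : ℚ) / (i : ℚ)

theorem F_eq_coeff (n k : ℕ) : F n k = PowerSeries.coeff n (logSer ^ k) := by
  have h1 : logSer ^ k = ∏ _j : Fin k, logSer := by simp
  rw [h1, PowerSeries.coeff_prod]
  unfold F
  rw [Finset.sum_filter_of_ne]
  · symm
    refine Finset.sum_bij (fun (f : Fin k →₀ ℕ) _ => (f : Fin k → ℕ)) ?_ ?_ ?_ ?_
    · intro f hf
      rw [Finset.Nat.mem_antidiagonalTuple]
      exact (Finset.mem_finsuppAntidiag.mp hf).1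
    · intro f _ g _ h
      exact DFunLike.coe_injective h
    · intro g hg
      rw [Finset.Nat.mem_antidiagonalTuple] at hg
      refine ⟨Finsupp.equivFunOnFinite.symm g, ?_, ?_⟩
      · rw [Finset.mem_finsuppAntidiag]
        exact ⟨by simpa using hg, Finset.subset_univ _⟩
      · simp
    · intro f _
      simp [logSer]
  · intro f _ hne j h0
    apply hne
    exact Finset.prod_eq_zero (Finset.mem_univ j) (by simp [h0])

theorem deriv_logSer :
    (1 - PowerSeries.X) * PowerSeries.derivative ℚ logSer = 1 := by
  have h : PowerSeries.derivative ℚ logSer = PowerSeries.mk 1 := by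
    ext n
    rw [PowerSeries.coeff_derivative]
    have : (n : ℚ) + 1 ≠ 0 := by positivity
    simp [logSer, this]
  rw [h, mul_comm, PowerSeries.mk_one_mul_one_sub_eq_one]

theorem F_recurrence (n k : ℕ) (hk : 0 < k) (hkn : k ≤ n) :
    F (n + 1) k = ((k : ℚ) / ((n : ℚ) + 1)) * F n (k - 1) +
      ((n : ℚ) / ((n : ℚ) + 1)) * F n k := by
  have key : PowerSeries.derivative ℚ (logSer ^ k) =
      PowerSeries.X * PowerSeries.derivative ℚ (logSer ^ k)
        + PowerSeries.C (k : ℚ) * logSer ^ (k - 1) := by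
    rw [PowerSeries.derivative_pow, map_natCast]
    linear_combination ((k : PowerSeries ℚ) * logSer ^ (k - 1)) * deriv_logSer
  obtain ⟨m, rfl⟩ : ∃ m, n = m + 1 := ⟨n - 1, by omega⟩
  have h := congrArg (PowerSeries.coeff (m + 1)) key
  rw [map_add, PowerSeries.coeff_succ_X_mul, PowerSeries.coeff_C_mul,
    PowerSeries.coeff_derivative, PowerSeries.coeff_derivative,
    ← F_eq_coeff, ← F_eq_coeff, ← F_eq_coeff] at h
  have : ((m + 1 : ℕ) : ℚ) + 1 ≠ 0 := by positivity
  field_simp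
  push_cast at h ⊢
  linarith
end

section
/- For every natural number n, the smallest positive integer λ such that λ·P^{(k)} is integer-valued for every integer-valued polynomial P of degree ≤ n and every natural number k equals ∏_{p prime} p^{⌊n/p⌋}. -/
open Polynomial

/-- A polynomial `P ∈ ℚ[X]` is integer-valued if it takes integer values at all integers. -/
def IntValued (P : Polynomial ℚ) : Prop := ∀ m : ℤ, ∃ z : ℤ, P.eval (m : ℚ) = (z : ℚ)

namespace LambdaAux

/-- the candidate value -/
def lam (n : ℕ) : ℕ := ∏ p ∈ (Finset.range (n + 1)).filter Nat.Prime, p ^ (n / p)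

lemma lam_ne_zero (n : ℕ) : lam n ≠ 0 := by
  unfold lam
  refine Finset.prod_ne_zero_iff.mpr fun p hp => ?_
  exact pow_ne_zero _ (Finset.mem_filter.mp hp).2.ne_zero

lemma lam_factorization (n p : ℕ) (hp : p.Prime) : (lam n).factorization p = n / p := by
  unfold lam
  rw [Nat.factorization_prod_apply
    (fun q hq => pow_ne_zero _ (Finset.mem_filter.mp hq).2.ne_zero)]
  have : ∀ q ∈ (Finset.range (n + 1)).filter Nat.Prime,
      (q ^ (n / q)).factorization p = if p = q then n / p else 0 := by
    intro q hq
    have hq' := (Finset.mem_filter.mp hq).2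
    rw [hq'.factorization_pow, Finsupp.single_apply]
    by_cases h : q = p
    · subst h; simp
    · rw [if_neg h, if_neg (Ne.symm h)]
  rw [Finset.sum_congr rfl this, Finset.sum_ite_eq]
  split_ifs with h
  · rfl
  · symm
    apply Nat.div_eq_of_lt
    by_contra hlt
    exact h (Finset.mem_filter.mpr ⟨Finset.mem_range.mpr (by omega), hp⟩)

lemma factorization_le_div (i p : ℕ) (hi : i ≠ 0) (hp : p.Prime) :
    i.factorization p ≤ i / p := by
  have hd : p ^ i.factorization p ∣ i := Nat.ordProj_dvd i p
  rcases hv : i.factorization p with _ | v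
  · exact Nat.zero_le _
  · rw [hv] at hd
    have h1 : p ^ (v + 1) ≤ i := Nat.le_of_dvd (Nat.pos_of_ne_zero hi) hd
    have h2 : v < p ^ v := Nat.lt_pow_self hp.one_lt
    rw [Nat.le_div_iff_mul_le hp.pos]
    calc (v + 1) * p ≤ p ^ v * p := Nat.mul_le_mul_right _ h2
      _ = p ^ (v + 1) := (pow_succ _ _).symm
      _ ≤ i := h1

lemma mul_lam_dvd (i m n : ℕ) (h : i + 1 + m ≤ n) : (i + 1) * lam m ∣ lam n := by
  rw [← Nat.factorization_prime_le_iff_dvd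
    (Nat.mul_ne_zero (Nat.succ_ne_zero i) (lam_ne_zero m)) (lam_ne_zero n)]
  intro p hp
  rw [Nat.factorization_mul (Nat.succ_ne_zero i) (lam_ne_zero m), Finsupp.add_apply,
    lam_factorization _ _ hp, lam_factorization _ _ hp]
  calc _ ≤ (i + 1) / p + m / p :=
        Nat.add_le_add_right (factorization_le_div _ _ (Nat.succ_ne_zero i) hp) _
    _ ≤ (i + 1 + m) / p := Nat.add_div_le_add_div _ _ _
    _ ≤ n / p := Nat.div_le_div_right h

/-- binomial polynomials -/
noncomputable def B (j : ℕ) : ℚ[X] := C ((j.factorial : ℚ)⁻¹) * descPochhammer ℚ j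

lemma B_zero : B 0 = 1 := by simp [B]

lemma B_nat (j m : ℕ) : (B j).eval (m : ℚ) = (m.choose j : ℚ) := by
  have : (j.factorial : ℚ) ≠ 0 := by exact_mod_cast j.factorial_ne_zero
  simp only [B, eval_mul, eval_C, descPochhammer_eval_eq_descFactorial]
  rw [Nat.descFactorial_eq_factorial_mul_choose]
  push_cast
  field_simp

lemma B_int (j : ℕ) : IntValued (B j) := by
  intro m
  refine ⟨Ring.choose m j, ?_⟩
  have h0 : (j.factorial : ℚ) ≠ 0 := by exact_mod_cast j.factorial_ne_zero
  have h := Ring.descPochhammer_eq_factorial_smul_choose m j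
  rw [← eval_eq_smeval] at h
  have h2 := congrArg (Int.cast : ℤ → ℚ) h
  rw [descPochhammer_eval_cast] at h2
  simp only [B, eval_mul, eval_C, h2]
  push_cast
  rw [nsmul_eq_mul]
  push_cast
  field_simp

lemma B_shift (j : ℕ) : (B (j + 1)).comp (X + 1) = B (j + 1) + B j := by
  apply eq_of_infinite_eval_eq
  refine (Set.infinite_range_of_injective (Nat.cast_injective (R := ℚ))).mono ?_
  rintro _ ⟨m, rfl⟩
  have := B_nat (j + 1) (m + 1)
  push_cast at this
  simp only [Set.mem_setOf_eq, eval_comp, eval_add, eval_X, eval_one, this, B_nat,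
    Nat.choose_succ_succ]
  push_cast
  ring

lemma desc_neg_one {R : Type*} [CommRing R] (m : ℕ) :
    (descPochhammer R m).eval (-1) = (-1) ^ m * (m.factorial : R) := by
  induction m with
  | zero => simp
  | succ m ih =>
    rw [descPochhammer_succ_eval, ih, Nat.factorial_succ]
    push_cast
    ring

lemma B_deriv_zero (j : ℕ) :
    (derivative (B (j + 1))).eval 0 = (-1) ^ j / ((j : ℚ) + 1) := by
  have h0 : (j.factorial : ℚ) ≠ 0 := by exact_mod_cast j.factorial_ne_zero
  have h1 : (j : ℚ) + 1 ≠ 0 := by positivity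
  have := desc_neg_one (R := ℚ) j
  simp only [B, descPochhammer_succ_left, derivative_mul, derivative_C, derivative_X, eval_add,
    eval_mul, eval_C, eval_X, eval_comp, eval_sub, eval_one, eval_zero, zero_mul, zero_add,
    one_mul, zero_sub, add_zero, this, Nat.factorial_succ]
  push_cast
  field_simp

lemma eq_zero_of_periodic (D : ℚ[X]) (h : D.comp (X + 1) = D) (h0 : D.eval 0 = 0) : D = 0 := by
  apply eq_of_infinite_eval_eq
  refine (Set.infinite_range_of_injective (Nat.cast_injective (R := ℚ))).mono ?_
  rintro _ ⟨m, rfl⟩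
  simp only [Set.mem_setOf_eq, eval_zero]
  induction m with
  | zero => simpa using h0
  | succ m ih =>
    have := congrArg (eval (m : ℚ)) h
    simp only [eval_comp, eval_add, eval_X, eval_one] at this
    push_cast
    rw [this, ih]

lemma B_eval_zero (j : ℕ) : (B j).eval 0 = if j = 0 then 1 else 0 := by
  have := B_nat j 0
  rcases j with _ | j <;> simpa using this

lemma B_deriv (j : ℕ) : derivative (B j) =
    ∑ i ∈ Finset.range j, C ((-1 : ℚ) ^ i / ((i : ℚ) + 1)) * B (j - 1 - i) := by
  induction j with
  | zero => simp [B_zero]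
  | succ j ih =>
    rw [← sub_eq_zero]
    apply eq_zero_of_periodic
    · have e1 : (derivative (B (j + 1))).comp (X + 1) =
          derivative (B (j + 1)) + derivative (B j) := by
        have := congrArg derivative (B_shift j)
        rw [derivative_comp] at this
        simpa using this
      rw [sub_comp, e1, ih, Polynomial.sum_comp, Finset.sum_range_succ, Finset.sum_range_succ]
      have e2 : ∀ i ∈ Finset.range j,
          (C ((-1 : ℚ) ^ i / ((i : ℚ) + 1)) * B (j + 1 - 1 - i)).comp (X + 1) =
          C ((-1 : ℚ) ^ i / ((i : ℚ) + 1)) * B (j + 1 - 1 - i) +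
          C ((-1 : ℚ) ^ i / ((i : ℚ) + 1)) * B (j - 1 - i) := by
        intro i hi
        have hi := Finset.mem_range.mp hi
        obtain ⟨k, rfl⟩ : ∃ k, j = i + 1 + k := ⟨j - (i + 1), by omega⟩
        rw [show i + 1 + k + 1 - 1 - i = k + 1 by omega, show i + 1 + k - 1 - i = k by omega,
          mul_comp, C_comp, B_shift]
        ring
      rw [Finset.sum_congr rfl e2, Finset.sum_add_distrib]
      simp only [Nat.add_sub_cancel, Nat.sub_self, B_zero, mul_one, C_comp]
      ring
    · rw [eval_sub, B_deriv_zero, eval_finsetSum, Finset.sum_range_succ, Finset.sum_eq_zero]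
      · simp [B_zero]
      · intro i hi
        have hi := Finset.mem_range.mp hi
        rw [eval_mul, B_eval_zero, if_neg (by omega), mul_zero]

lemma IntValued.int_mul {P : ℚ[X]} (h : IntValued P) (a : ℤ) : IntValued (C (a : ℚ) * P) := by
  intro m
  obtain ⟨z, hz⟩ := h m
  exact ⟨a * z, by simp [hz]⟩

lemma IntValued.sum {ι : Type*} (s : Finset ι) (f : ι → ℚ[X]) (h : ∀ i ∈ s, IntValued (f i)) :
    IntValued (∑ i ∈ s, f i) := by
  classical
  intro m
  choose! g hg using fun i hi => h i hi m
  refine ⟨∑ i ∈ s, g i, ?_⟩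
  rw [eval_finsetSum]
  push_cast
  exact Finset.sum_congr rfl hg

lemma B_main (k : ℕ) : ∀ j n : ℕ, j ≤ n → IntValued (C (lam n : ℚ) * derivative^[k] (B j)) := by
  induction k with
  | zero =>
    intro j n _
    simpa using IntValued.int_mul (B_int j) (lam n : ℤ)
  | succ k ih =>
    intro j n hj
    rw [Function.iterate_succ_apply, B_deriv, iterate_derivative_sum, Finset.mul_sum]
    refine IntValued.sum _ _ fun i hi => ?_
    have hi := Finset.mem_range.mp hi
    obtain ⟨c, hc⟩ := mul_lam_dvd i (j - 1 - i) n (by omega)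
    have h1 := IntValued.int_mul (ih (j - 1 - i) (j - 1 - i) le_rfl) ((-1) ^ i * (c : ℤ))
    convert h1 using 1
    rw [iterate_derivative_C_mul, ← mul_assoc, ← mul_assoc, ← C_mul, ← C_mul, hc]
    have : (i : ℚ) + 1 ≠ 0 := by positivity
    congr 2
    push_cast
    field_simp

lemma newton (n : ℕ) (P : ℚ[X]) (hP : IntValued P) (hd : P.natDegree ≤ n) :
    ∃ a : ℕ → ℤ, P = ∑ j ∈ Finset.range (n + 1), C (a j : ℚ) * B j := by
  choose f hf using hP
  refine ⟨fun j => (fwdDiff (1 : ℤ))^[j] f 0, ?_⟩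
  have hcard : ((Finset.range (n + 1)).image (Nat.cast : ℕ → ℚ)).card = n + 1 := by
    rw [Finset.card_image_of_injective _ Nat.cast_injective, Finset.card_range]
  apply eq_of_degrees_lt_of_eval_finset_eq ((Finset.range (n + 1)).image (Nat.cast : ℕ → ℚ))
  · rw [hcard]
    exact lt_of_le_of_lt degree_le_natDegree (by exact_mod_cast Nat.lt_succ_of_le hd)
  · rw [hcard]
    refine lt_of_le_of_lt degree_le_natDegree ?_
    have : (∑ j ∈ Finset.range (n + 1),
        C (((fwdDiff (1 : ℤ))^[j] f 0 : ℤ) : ℚ) * B j).natDegree ≤ n := by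
      refine natDegree_sum_le_of_forall_le _ _ fun j hj => ?_
      have hj := Finset.mem_range.mp hj
      refine (natDegree_C_mul_le _ _).trans ((natDegree_C_mul_le _ _).trans ?_)
      rw [descPochhammer_natDegree]
      omega
    exact_mod_cast Nat.lt_succ_of_le this
  · intro x hx
    obtain ⟨m, hm, rfl⟩ := Finset.mem_image.mp hx
    have hm := Finset.mem_range.mp hm
    have h := shift_eq_sum_fwdDiff_iter (1 : ℤ) f m 0
    have h1 : P.eval (m : ℚ) = (f m : ℚ) := by simpa using hf m
    rw [h1]
    have h2 : f (0 + m • 1) = f m := by simp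
    rw [← h2, h, eval_finsetSum]
    push_cast
    rw [← Finset.sum_subset (Finset.range_subset_range.mpr (show m + 1 ≤ n + 1 by omega))]
    · refine Finset.sum_congr rfl fun j _ => ?_
      rw [eval_mul, eval_C, B_nat, nsmul_eq_mul]
      push_cast
      ring
    · intro j _ hj
      rw [Finset.mem_range] at hj
      rw [eval_mul, B_nat, Nat.choose_eq_zero_of_lt (by omega)]
      simp

lemma coeff_ne (p q : ℕ) (hp : p.Prime) :
    ¬ (p : ℤ) ∣ (descPochhammer ℤ (p * q)).coeff q := by
  haveI : Fact p.Prime := ⟨hp⟩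
  rw [← ZMod.intCast_zmod_eq_zero_iff_dvd]
  have h1 : (((descPochhammer ℤ (p * q)).coeff q : ℤ) : ZMod p) =
      (descPochhammer (ZMod p) (p * q)).coeff q := by
    rw [← descPochhammer_map (Int.castRingHom (ZMod p)), coeff_map]
    simp
  have h2 : ∀ r : ℕ, descPochhammer (ZMod p) (p * r) = (descPochhammer (ZMod p) p) ^ r := by
    intro r
    induction r with
    | zero => simp
    | succ r ih =>
      rw [Nat.mul_succ, ← descPochhammer_mul, ih, pow_succ]
      congr 1
      have : ((p * r : ℕ) : (ZMod p)[X]) = 0 := by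
        rw [← C_eq_natCast]; simp
      rw [this, sub_zero, comp_X]
  rw [h1, h2]
  obtain ⟨s, rfl⟩ : ∃ s, p = s + 1 := ⟨p - 1, by have := hp.pos; omega⟩
  rw [descPochhammer_succ_left, mul_pow, coeff_X_pow_mul', if_pos le_rfl, Nat.sub_self,
    coeff_zero_eq_eval_zero, eval_pow, eval_comp]
  simp only [eval_sub, eval_X, eval_one, zero_sub, desc_neg_one]
  refine pow_ne_zero _ (mul_ne_zero (pow_ne_zero _ (neg_ne_zero.mpr one_ne_zero)) ?_)
  rw [Ne, ZMod.natCast_eq_zero_iff, hp.dvd_factorial]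
  omega

lemma lower (n l p : ℕ) (hl : 0 < l) (hp : p.Prime)
    (h : ∀ P : Polynomial ℚ, IntValued P → P.natDegree ≤ n →
        ∀ k : ℕ, IntValued (C (l : ℚ) * derivative^[k] P)) : p ^ (n / p) ∣ l := by
  haveI : Fact p.Prime := ⟨hp⟩
  set q := n / p with hq
  have hdeg : (B (p * q)).natDegree ≤ n := by
    refine (natDegree_C_mul_le _ _).trans ?_
    rw [descPochhammer_natDegree]
    exact Nat.mul_div_le n p
  obtain ⟨z, hz⟩ := h _ (B_int (p * q)) hdeg q 0
  set s := (descPochhammer ℤ (p * q)).coeff q with hs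
  have hc : (descPochhammer ℚ (p * q)).coeff q = (s : ℚ) := by
    rw [← descPochhammer_map (Int.castRingHom ℚ), coeff_map]
    simp [hs]
  have h0 : ((p * q).factorial : ℚ) ≠ 0 := by exact_mod_cast (p * q).factorial_ne_zero
  rw [eval_mul, eval_C, Int.cast_zero, ← coeff_zero_eq_eval_zero, coeff_iterate_derivative,
    zero_add, Nat.descFactorial_self, B, coeff_C_mul, hc, nsmul_eq_mul] at hz
  have hz2 : ((l * q.factorial : ℕ) : ℚ) * s = z * ((p * q).factorial : ℕ) := by
    field_simp at hz
    push_cast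
    linarith
  have hz3 : ((l * q.factorial : ℕ) : ℤ) * s = z * ((p * q).factorial : ℕ) := by
    exact_mod_cast hz2
  have hv := padicValNat_factorial_mul (p := p) q
  set v := padicValNat p q.factorial with hvdef
  have hd : p ^ (v + q) ∣ (p * q).factorial := by
    rw [← hv]; exact pow_padicValNat_dvd
  have hd2 : ((p ^ (v + q) : ℕ) : ℤ) ∣ ((l * q.factorial : ℕ) : ℤ) * s := by
    rw [hz3]
    exact (Int.natCast_dvd_natCast.mpr hd).mul_left z
  have hcop : IsCoprime ((p ^ (v + q) : ℕ) : ℤ) s := by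
    push_cast
    apply IsCoprime.pow_left
    exact (Prime.coprime_iff_not_dvd (Nat.prime_iff_prime_int.mp hp)).mpr (coeff_ne p q hp)
  have hd3 : p ^ (v + q) ∣ l * q.factorial :=
    Int.natCast_dvd_natCast.mp (hcop.dvd_of_dvd_mul_right hd2)
  have hne : l * q.factorial ≠ 0 := Nat.mul_ne_zero hl.ne' q.factorial_ne_zero
  rw [padicValNat_dvd_iff_le hne, padicValNat.mul hl.ne' q.factorial_ne_zero] at hd3
  rw [padicValNat_dvd_iff_le hl.ne']
  omega

end LambdaAux

open LambdaAux in
theorem isLeast_lambda (n : ℕ) :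
    IsLeast {l : ℕ | 0 < l ∧ ∀ P : Polynomial ℚ, IntValued P → P.natDegree ≤ n →
        ∀ k : ℕ, IntValued (C (l : ℚ) * derivative^[k] P)}
      (∏ p ∈ (Finset.range (n + 1)).filter Nat.Prime, p ^ (n / p)) := by
  change IsLeast _ (lam n)
  constructor
  · refine ⟨Nat.pos_of_ne_zero (lam_ne_zero n), fun P hP hd k => ?_⟩
    obtain ⟨a, ha⟩ := newton n P hP hd
    rw [ha, iterate_derivative_sum, Finset.mul_sum]
    refine IntValued.sum _ _ fun j hj => ?_
    have hj := Finset.mem_range.mp hj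
    have := IntValued.int_mul (B_main k j n (by omega)) (a j)
    rw [iterate_derivative_C_mul]
    convert this using 1
    ring
  · rintro l ⟨hl, h⟩
    apply Nat.le_of_dvd hl
    unfold lam
    refine Finset.prod_dvd_of_isRelPrime ?_ ?_
    · intro p hp q hq hpq
      exact Nat.coprime_iff_isRelPrime.mp (Nat.Coprime.pow _ _
        ((Nat.coprime_primes (Finset.mem_filter.mp hp).2 (Finset.mem_filter.mp hq).2).mpr hpq))
    · intro p hp
      exact lower n l p hl (Finset.mem_filter.mp hp).2 h
end
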